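/- Let β > 1 be real and let w ∈ {0,1}^ω have 1's exactly at positions 3^n for n ∈ ℕ (and 0's elsewhere). If β = p/q is rational with p, q coprime, q ≥ 2, and p/q > 2, then ∑_{i=1}^∞ w(i)·β^{−i} is irrational. -/

import Mathlib

section MahlerAux
open Polynomial Filter Topology Asymptotics

lemma exists_aux (d : ℕ) (hd : 1 ≤ d) (T : ℤ[X]) : ∃ P : ℕ → ℤ[X], (∃ j ≤ d, P j ≠ 0) ∧
    (∀ j, (P j).natDegree ≤ d) ∧
    (X : ℤ[X]) ^ (d * d) ∣ ∑ j ∈ Finset.range (d + 1), P j * T ^ j := by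
  let A : Matrix (Fin (d * d)) (Fin (d + 1) × Fin (d + 1)) ℤ :=
    fun r ij => ((X : ℤ[X]) ^ (ij.1 : ℕ) * T ^ (ij.2 : ℕ)).coeff r
  obtain ⟨t, ht0, ht, -⟩ := Int.Matrix.exists_ne_zero_int_vec_norm_le A
    (by simp; nlinarith) (by simp; nlinarith)
  let P : ℕ → ℤ[X] := fun j => if h : j < d + 1 then
    ∑ i : Fin (d + 1), C (t (i, ⟨j, h⟩)) * X ^ (i : ℕ) else 0
  have hP : ∀ j : Fin (d + 1), P j = ∑ i : Fin (d + 1), C (t (i, j)) * X ^ (i : ℕ) := by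
    intro j
    simp only [P, dif_pos j.2]
  refine ⟨P, ?_, ?_, ?_⟩
  · by_contra! hcon
    apply ht0
    funext ⟨i, j⟩
    have h1 := hcon j (by have := j.2; omega)
    rw [hP] at h1
    have h2 := congrArg (fun Q => Q.coeff (i : ℕ)) h1
    simpa [finsetSum_coeff, coeff_C_mul, coeff_X_pow, Fin.val_inj] using h2
  · intro j
    by_cases h : j < d + 1
    · simp only [P, h, dif_pos]
      apply natDegree_sum_le_of_forall_le
      intro i _
      exact (natDegree_C_mul_X_pow_le _ _).trans (by have := i.2; omega)
    · simp only [P, dif_neg h, natDegree_zero, zero_le]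
  · rw [X_pow_dvd_iff]
    intro r hr
    have h1 := congrFun ht ⟨r, hr⟩
    rw [Finset.sum_range, finsetSum_coeff]
    simp only [hP, Finset.sum_mul, finsetSum_coeff, mul_assoc, coeff_C_mul]
    simp only [Matrix.mulVec, dotProduct, A, Fintype.sum_prod_type] at h1
    rw [Finset.sum_comm]
    simpa [mul_comm] using h1

lemma int_eval (P : ℤ[X]) (d : ℕ) (hP : P.natDegree ≤ d) (u v : ℤ) (x : ℂ) (h : v * x = u) :
    ∃ I : ℤ, (v : ℂ) ^ d * aeval x P = I := by
  refine ⟨∑ i ∈ Finset.range (d + 1), P.coeff i * u ^ i * v ^ (d - i), ?_⟩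
  rw [aeval_eq_sum_range' (n := d + 1) (by omega), Finset.mul_sum]
  push_cast
  apply Finset.sum_congr rfl
  intro i hi
  have : d = i + (d - i) := by have := Finset.mem_range.1 hi; omega
  conv_lhs => rw [this]
  rw [pow_add, ← h, mul_pow]
  simp
  ring

/-- the Mahler function -/
noncomputable def mahlerF (x : ℂ) : ℂ := ∑' n : ℕ, x ^ 3 ^ n

lemma mF_bound (x : ℂ) (r : ℝ) (hx : ‖x‖ ≤ r) (hr : r < 1) (n : ℕ) : ‖x ^ 3 ^ n‖ ≤ r ^ n := by
  rw [norm_pow]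
  calc ‖x‖ ^ 3 ^ n ≤ r ^ 3 ^ n := by gcongr
    _ ≤ r ^ n := pow_le_pow_of_le_one ((norm_nonneg _).trans hx) hr.le (Nat.lt_pow_self (by norm_num)).le

lemma mF_summable (x : ℂ) (hx : ‖x‖ < 1) : Summable (fun n : ℕ => x ^ 3 ^ n) :=
  Summable.of_norm_bounded (summable_geometric_of_lt_one (norm_nonneg _) hx)
    (mF_bound x _ le_rfl hx)

lemma mF_diff : DifferentiableOn ℂ mahlerF (Metric.ball 0 1) := by
  intro x hx
  have hx : ‖x‖ < 1 := by simpa using hx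
  obtain ⟨r, h1, h2⟩ := exists_between hx
  have h0 : 0 ≤ r := (norm_nonneg x).trans h1.le
  have : DifferentiableOn ℂ mahlerF (Metric.ball 0 r) := by
    apply Complex.differentiableOn_tsum_of_summable_norm (summable_geometric_of_lt_one h0 h2)
    · intro i; fun_prop
    · exact Metric.isOpen_ball
    · intro i w hw
      exact mF_bound w r (by simpa using (Metric.mem_ball.1 hw).le) h2 i
  exact ((this x (by simpa using h1)).differentiableAt
    (Metric.isOpen_ball.mem_nhds (by simpa using h1))).differentiableWithinAt

lemma mF_split (x : ℂ) (hx : ‖x‖ < 1) (k : ℕ) :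
    mahlerF x = ∑ n ∈ Finset.range k, x ^ 3 ^ n + mahlerF (x ^ 3 ^ k) := by
  rw [mahlerF, ← (mF_summable x hx).sum_add_tsum_nat_add k, mahlerF]
  congr 2
  funext n
  rw [← pow_mul, ← pow_add, add_comm]

lemma mF_contAt : ContinuousAt mahlerF 0 :=
  (mF_diff.differentiableAt (Metric.isOpen_ball.mem_nhds (by simp))).continuousAt

lemma mF_zero : mahlerF 0 = 0 := by simp [mahlerF]

lemma mF_bigO : mahlerF =O[𝓝 0] (fun x => x) := by
  have h := (mF_diff.differentiableAt (x := 0) (Metric.isOpen_ball.mem_nhds (by simp))).isBigO_sub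
  simpa [mF_zero] using h

lemma pow_sub_bigO {f T g : ℂ → ℂ} (hf : f =O[𝓝 0] (fun _ => (1 : ℂ)))
    (hT : T =O[𝓝 0] (fun _ => (1 : ℂ))) (h : (fun x => f x - T x) =O[𝓝 0] g) (j : ℕ) :
    (fun x => f x ^ j - T x ^ j) =O[𝓝 0] g := by
  induction j with
  | zero => simpa using isBigO_zero _ _
  | succ j ih =>
    have e : (fun x => f x ^ (j + 1) - T x ^ (j + 1)) =
      fun x => f x ^ j * (f x - T x) + T x * (f x ^ j - T x ^ j) := by funext x; ring
    rw [e]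
    apply IsBigO.add
    · simpa using (hf.pow j).mul h
    · simpa using hT.mul ih

/-- the auxiliary function -/
noncomputable def auxE (P : ℕ → ℤ[X]) (d : ℕ) (x : ℂ) : ℂ :=
  ∑ j ∈ Finset.range (d + 1), aeval x (P j) * mahlerF x ^ j

lemma auxE_bigO (P : ℕ → ℤ[X]) (d M L : ℕ) (hL : M ≤ 3 ^ L)
    (hP : (X : ℤ[X]) ^ M ∣ ∑ j ∈ Finset.range (d + 1), P j *
      (∑ n ∈ Finset.range L, (X : ℤ[X]) ^ 3 ^ n) ^ j) :
    auxE P d =O[𝓝 0] (fun x => x ^ M) := by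
  set T : ℤ[X] := ∑ n ∈ Finset.range L, (X : ℤ[X]) ^ 3 ^ n with hT
  have hc : ∀ Q : ℤ[X], (fun x : ℂ => aeval x Q) =O[𝓝 0] (fun _ => (1 : ℂ)) := fun Q =>
    (Polynomial.continuous_aeval Q).continuousAt.tendsto.isBigO_one ℂ
  have h1 : (fun x => mahlerF x - aeval x T) =O[𝓝 0] (fun x => x ^ M) := by
    have h2 : (fun x : ℂ => mahlerF (x ^ 3 ^ L)) =O[𝓝 0] (fun x => x ^ 3 ^ L) := by
      apply mF_bigO.comp_tendsto
      have : ContinuousAt (fun x : ℂ => x ^ 3 ^ L) 0 := by fun_prop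
      simpa [ContinuousAt] using this
    have h3 : (fun x : ℂ => x ^ 3 ^ L) =O[𝓝 0] (fun x => x ^ M) := by
      have : (fun x : ℂ => x ^ 3 ^ L) = fun x => x ^ (3 ^ L - M) * x ^ M := by
        funext x; rw [← pow_add]; congr 1; omega
      rw [this]
      simpa using (hc (X ^ (3 ^ L - M))).mul (isBigO_refl (fun x : ℂ => x ^ M) (𝓝 0))
    refine (h2.trans h3).congr' ?_ EventuallyEq.rfl
    filter_upwards [Metric.ball_mem_nhds (0 : ℂ) one_pos] with x hx
    rw [mF_split x (by simpa using hx) L]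
    simp [hT]
  obtain ⟨R, hR⟩ := hP
  have e : auxE P d = fun x => ∑ j ∈ Finset.range (d + 1),
      aeval x (P j) * (mahlerF x ^ j - aeval x T ^ j) + aeval x R * x ^ M := by
    funext x
    have := congrArg (aeval x) hR
    simp only [map_sum, map_mul, map_pow, aeval_X] at this
    rw [mul_comm (aeval x R), ← this, ← Finset.sum_add_distrib, auxE]
    apply Finset.sum_congr rfl
    intros; ring
  rw [e]
  apply IsBigO.add
  · apply IsBigO.fun_sum
    intro j _
    simpa using (hc (P j)).mul
      (pow_sub_bigO (mF_contAt.tendsto.isBigO_one ℂ) (hc T) h1 j)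
  · simpa using (hc R).mul (isBigO_refl (fun x : ℂ => x ^ M) (𝓝 0))

lemma gR_summable (x : ℝ) (h0 : 0 < x) (h1 : x < 1) : Summable (fun n : ℕ => x ^ 3 ^ n) := by
  refine Summable.of_nonneg_of_le (fun n => by positivity) (fun n => ?_)
    (summable_geometric_of_lt_one h0.le h1)
  exact pow_le_pow_of_le_one h0.le h1.le (Nat.lt_pow_self (by norm_num)).le

/-- the real Mahler function -/
noncomputable def gR (x : ℝ) : ℝ := ∑' n : ℕ, x ^ 3 ^ n

lemma Ioo_mem : ∀ᶠ x : ℝ in 𝓝[<] 1, 0 < x ∧ x < 1 := by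
  have := Ioo_mem_nhdsLT (show (0:ℝ) < 1 by norm_num)
  exact this

lemma gR_atTop : Tendsto gR (𝓝[<] 1) atTop := by
  rw [tendsto_atTop]
  intro b
  obtain ⟨N, hN⟩ := exists_nat_gt b
  have hc : Tendsto (fun x : ℝ => ∑ n ∈ Finset.range N, x ^ 3 ^ n) (𝓝[<] 1) (𝓝 N) := by
    have : ContinuousAt (fun x : ℝ => ∑ n ∈ Finset.range N, x ^ 3 ^ n) 1 := by fun_prop
    have h := this.tendsto.mono_left (nhdsWithin_le_nhds (s := Set.Iio 1))
    simpa using h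
  filter_upwards [hc.eventually_const_lt hN, Ioo_mem] with x hx hx1
  exact hx.le.trans ((gR_summable x hx1.1 hx1.2).sum_le_tsum _ (fun n _ => by have := hx1.1; positivity))

lemma pow_bd (x s : ℝ) (hs0 : 0 < s) (hs : s ≤ 1) (h0 : 0 < x) (h1 : x < 1) (t : ℕ) (ht : 0 < t) :
    x ^ t ≤ (t : ℝ) ^ (-s) * (1 - x) ^ (-s) := by
  have ht' : (0 : ℝ) < t := by exact_mod_cast ht
  have hx : 0 < 1 - x := by linarith
  rw [← Real.mul_rpow ht'.le hx.le]
  set u := (t : ℝ) * (1 - x) with hu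
  have hu0 : 0 < u := by positivity
  have h2 : x ^ t ≤ Real.exp (-u) := by
    have : x ≤ Real.exp (-(1 - x)) := by
      have := Real.add_one_le_exp (-(1 - x)); linarith
    calc x ^ t ≤ Real.exp (-(1 - x)) ^ t := by gcongr
      _ = Real.exp (-u) := by rw [← Real.exp_nat_mul]; congr 1; rw [hu]; ring
  refine h2.trans ?_
  rw [Real.exp_neg, Real.rpow_neg hu0.le]
  apply inv_anti₀ (by positivity)
  have h3 := Real.add_one_le_exp u
  rcases le_total u 1 with h | h
  · have := Real.rpow_le_one hu0.le h hs0.le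
    linarith
  · have := Real.rpow_le_rpow_of_exponent_le h hs
    rw [Real.rpow_one] at this
    linarith

lemma gR_le (s : ℝ) (hs0 : 0 < s) (hs : s ≤ 1) : ∃ C : ℝ, 0 ≤ C ∧ ∀ x : ℝ, 0 < x → x < 1 →
    gR x ≤ C * (1 - x) ^ (-s) := by
  have hsum : Summable (fun n : ℕ => (((3 : ℝ) ^ (-s)) ^ n)) := by
    apply summable_geometric_of_lt_one (by positivity)
    exact Real.rpow_lt_one_of_one_lt_of_neg (by norm_num) (by linarith)
  refine ⟨∑' n : ℕ, (((3 : ℝ) ^ (-s)) ^ n), tsum_nonneg (fun n => by positivity), ?_⟩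
  intro x h0 h1
  rw [← tsum_mul_right]
  refine (gR_summable x h0 h1).tsum_le_tsum (fun n => ?_) (hsum.mul_right _)
  refine (pow_bd x s hs0 hs h0 h1 (3 ^ n) (by positivity)).trans (le_of_eq ?_)
  congr 1
  push_cast
  rw [← Real.rpow_natCast, ← Real.rpow_natCast, ← Real.rpow_mul (by norm_num),
    ← Real.rpow_mul (by norm_num), mul_comm]

lemma gR_growth (k : ℕ) : Tendsto (fun x => (x - 1) * gR x ^ k) (𝓝[<] 1) (𝓝 0) := by
  set s : ℝ := 1 / (2 * (k + 1)) with hs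
  have hs0 : 0 < s := by positivity
  have hs1 : s ≤ 1 := by
    rw [hs, div_le_one (by positivity)]; have : (0:ℝ) ≤ k := by positivity
    linarith
  have hk : 0 < 1 - s * k := by
    rw [hs]; have : (0:ℝ) ≤ k := by positivity
    rw [sub_pos, div_mul_eq_mul_div, div_lt_one (by positivity)]; linarith
  obtain ⟨C, hC, hb⟩ := gR_le s hs0 hs1
  have hlim : Tendsto (fun x : ℝ => C ^ k * (1 - x) ^ (1 - s * k)) (𝓝[<] 1) (𝓝 0) := by
    have h1 : ContinuousAt (fun x : ℝ => C ^ k * (1 - x) ^ (1 - s * k)) 1 := by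
      apply ContinuousAt.mul continuousAt_const
      apply ContinuousAt.rpow_const (by fun_prop)
      right; exact hk.le
    have h := h1.tendsto.mono_left (nhdsWithin_le_nhds (s := Set.Iio 1))
    simpa [Real.zero_rpow hk.ne'] using h
  refine squeeze_zero_norm' ?_ hlim
  filter_upwards [Ioo_mem] with x ⟨h0, h1⟩
  have hx : 0 < 1 - x := by linarith
  have hg : 0 ≤ gR x := tsum_nonneg (fun n => by positivity)
  rw [norm_mul, norm_pow, Real.norm_of_nonneg hg, Real.norm_eq_abs, abs_sub_comm, abs_of_pos hx]
  calc (1 - x) * gR x ^ k ≤ (1 - x) * (C * (1 - x) ^ (-s)) ^ k := by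
        gcongr; exact hb x h0 h1
    _ = C ^ k * ((1 - x) ^ (1 : ℝ) * ((1 - x) ^ (-s)) ^ k) := by rw [Real.rpow_one]; ring
    _ = _ := by
      rw [← Real.rpow_natCast ((1 - x) ^ (-s)), ← Real.rpow_mul hx.le, ← Real.rpow_add hx]
      congr 2; ring

lemma root_one (P : ℕ → ℝ[X]) (d : ℕ)
    (h : ∀ x : ℝ, 0 < x → x < 1 → ∑ j ∈ Finset.range (d + 1), (P j).eval x * gR x ^ j = 0) :
    ∀ J ≤ d, (P J).eval 1 = 0 := by
  have key : ∀ n J, J + n = d → (P J).eval 1 = 0 := by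
    intro n
    induction n using Nat.strong_induction_on with
    | _ n ih =>
    intro J hJ
    have hbig : ∀ j, J < j → j ≤ d → (P j).eval 1 = 0 := fun j h1 h2 =>
      ih (d - j) (by omega) j (by omega)
    have hc : ∀ Q : ℝ[X], Tendsto (fun x => Q.eval x) (𝓝[<] 1) (𝓝 (Q.eval 1)) := fun Q =>
      Q.continuous.continuousAt.tendsto.mono_left nhdsWithin_le_nhds
    have hpos : ∀ᶠ x in 𝓝[<] (1 : ℝ), 0 < gR x := gR_atTop.eventually_gt_atTop 0
    have hterm : ∀ j ∈ Finset.range (d + 1),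
        Tendsto (fun x => (P j).eval x * gR x ^ j / gR x ^ J) (𝓝[<] 1)
          (𝓝 (if j = J then (P J).eval 1 else 0)) := by
      intro j hj
      rcases lt_trichotomy j J with hlt | heq | hgt
      · rw [if_neg hlt.ne]
        have h1 : Tendsto (fun x => (gR x ^ (J - j))⁻¹) (𝓝[<] 1) (𝓝 0) :=
          ((tendsto_pow_atTop (by omega)).comp gR_atTop).inv_tendsto_atTop
        have h2 := (hc (P j)).mul h1
        rw [mul_zero] at h2
        refine h2.congr' ?_
        filter_upwards [hpos] with x hx
        have : J = j + (J - j) := by omega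
        conv_rhs => rw [this, pow_add]
        field_simp
      · subst heq
        rw [if_pos rfl]
        refine (hc (P j)).congr' ?_
        filter_upwards [hpos] with x hx
        field_simp
      · rw [if_neg hgt.ne']
        obtain ⟨R, hR⟩ := dvd_iff_isRoot.2 (hbig j hgt (by have := Finset.mem_range.1 hj; omega))
        have h2 := (hc R).mul (gR_growth (j - J))
        rw [mul_zero] at h2
        refine h2.congr' ?_
        filter_upwards [hpos] with x hx
        have : j = J + (j - J) := by omega
        conv_rhs => rw [hR, this, pow_add]
        simp
        field_simp
    have hs := tendsto_finsetSum _ hterm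
    rw [Finset.sum_ite_eq' , if_pos (by simp; omega)] at hs
    refine tendsto_nhds_unique (hs.congr' (f₂ := fun _ => 0) ?_) tendsto_const_nhds
    filter_upwards [Ioo_mem] with x hx
    rw [← Finset.sum_div, h x hx.1 hx.2, zero_div]
  intro J hJ
  exact key (d - J) J (by omega)

lemma transc_dvd (d n : ℕ) : ∀ P : ℕ → ℝ[X],
    (∀ x : ℝ, 0 < x → x < 1 → ∑ j ∈ Finset.range (d + 1), (P j).eval x * gR x ^ j = 0) →
    ∀ j ≤ d, (X - C 1 : ℝ[X]) ^ n ∣ P j := by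
  induction n with
  | zero => intro P _ j _; simp
  | succ n ih =>
    intro P h
    have hr := root_one P d h
    have : ∀ j, ∃ R, j ≤ d → P j = (X - C 1) * R := by
      intro j
      by_cases hj : j ≤ d
      · obtain ⟨R, hR⟩ := dvd_iff_isRoot.2 (hr j hj)
        exact ⟨R, fun _ => hR⟩
      · exact ⟨0, fun h => absurd h hj⟩
    choose R hR using this
    intro j hj
    rw [hR j hj, pow_succ']
    apply mul_dvd_mul_left
    refine ih R ?_ j hj
    intro x h0 h1
    have h2 := h x h0 h1
    have h3 : (x - 1) * ∑ j ∈ Finset.range (d + 1), (R j).eval x * gR x ^ j = 0 := by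
      rw [← h2, Finset.mul_sum]
      apply Finset.sum_congr rfl
      intro i hi
      rw [hR i (by have := Finset.mem_range.1 hi; omega)]
      simp; ring
    rcases mul_eq_zero.1 h3 with h4 | h4
    · linarith
    · exact h4

lemma transc (d : ℕ) (P : ℕ → ℝ[X])
    (h : ∀ x : ℝ, 0 < x → x < 1 → ∑ j ∈ Finset.range (d + 1), (P j).eval x * gR x ^ j = 0) :
    ∀ j ≤ d, P j = 0 := by
  intro j hj
  by_contra hne
  have h1 := natDegree_le_of_dvd (transc_dvd d ((P j).natDegree + 1) P h j hj) hne
  rw [natDegree_pow, natDegree_X_sub_C] at h1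
  omega

lemma auxE_ne (P : ℕ → ℤ[X]) (d : ℕ) (hP : ∃ j ≤ d, P j ≠ 0) :
    ∀ᶠ x in 𝓝[≠] (0 : ℂ), auxE P d x ≠ 0 := by
  have hd : DifferentiableOn ℂ (auxE P d) (Metric.ball 0 1) := by
    unfold auxE
    apply DifferentiableOn.fun_sum
    intro j _
    exact ((Polynomial.differentiable_aeval (P j)).differentiableOn).mul (mF_diff.pow j)
  have han := hd.analyticOnNhd Metric.isOpen_ball
  rcases (han 0 (by simp)).eventually_eq_zero_or_eventually_ne_zero with h | h
  · exfalso
    have hz := han.eqOn_zero_of_preconnected_of_eventuallyEq_zero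
      (convex_ball _ _).isPreconnected (by simp : (0 : ℂ) ∈ Metric.ball 0 1) h
    obtain ⟨j, hj, hne⟩ := hP
    have h2 := transc d (fun j => (P j).map (Int.castRingHom ℝ)) (fun x h0 h1 => by
      have h3 : auxE P d (x : ℂ) = 0 := hz (by simp [abs_of_pos h0, h1])
      rw [auxE] at h3
      have hg : mahlerF (x : ℂ) = (gR x : ℂ) := by
        rw [mahlerF, gR]; push_cast; rfl
      rw [hg] at h3
      apply Complex.ofReal_injective
      rw [Complex.ofReal_zero, ← h3]
      push_cast
      apply Finset.sum_congr rfl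
      intro i _
      congr 1
      simp only [aeval_def, eval_map, eval₂_eq_sum_range]
      push_cast
      simp) j hj
    apply hne
    exact (Polynomial.map_eq_zero_iff (RingHom.injective_int _)).1 h2
  · exact h

lemma tsum_word (w : ℕ → ℝ) (z : ℝ)
    (hw1 : ∀ i, (∃ n : ℕ, i + 1 = 3 ^ n) → w i = 1)
    (hw0 : ∀ i, ¬ (∃ n : ℕ, i + 1 = 3 ^ n) → w i = 0) :
    ∑' i : ℕ, w i * z ^ (i + 1) = gR z := by
  have hsub : ∀ n : ℕ, 3 ^ n - 1 + 1 = 3 ^ n := fun n =>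
    Nat.sub_add_cancel (Nat.one_le_pow _ _ (by norm_num))
  have hinj : Function.Injective (fun n : ℕ => 3 ^ n - 1) := by
    intro a b h
    have h : 3 ^ a - 1 = 3 ^ b - 1 := h
    have h2 : 3 ^ a = 3 ^ b := by rw [← hsub a, ← hsub b, h]
    exact Nat.pow_right_injective (le_refl 2 |>.trans (by norm_num)) h2
  rw [← hinj.tsum_eq (f := fun i => w i * z ^ (i + 1)), gR]
  · apply tsum_congr
    intro n
    rw [hsub, hw1 _ ⟨n, hsub n⟩, one_mul]
  · intro i hi
    by_contra hcon
    apply hi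
    have : w i = 0 := hw0 i (fun ⟨n, hn⟩ => hcon ⟨n, by simp [← hn]⟩)
    simp [this]

lemma gR_irr (p q : ℕ) (hq : 0 < q) (hpq : q < p) : Irrational (gR ((q : ℝ) / p)) := by
  rintro ⟨α, hα⟩
  have hp0 : 0 < p := by omega
  have hpR : (0 : ℝ) < p := by exact_mod_cast hp0
  have hqR : (0 : ℝ) < q := by exact_mod_cast hq
  have hpC : (p : ℂ) ≠ 0 := by exact_mod_cast hp0.ne'
  set z : ℝ := (q : ℝ) / p with hz
  have hz0 : 0 < z := by positivity
  have hz1 : z < 1 := by rw [hz, div_lt_one hpR]; exact_mod_cast hpq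
  have hzn : ‖(z : ℂ)‖ = z := by simp [abs_of_pos hz0]
  have hpz : (p : ℂ) * z = q := by rw [hz]; push_cast; field_simp
  -- the value
  have hval : mahlerF (z : ℂ) = (α.num : ℂ) / α.den := by
    have hg : mahlerF (z : ℂ) = (gR z : ℂ) := by
      rw [mahlerF, gR]; push_cast; rfl
    rw [hg, ← hα]
    conv_lhs => rw [← Rat.num_div_den α]
    push_cast; rfl
  set b : ℕ := α.den with hb
  have hb0 : (b : ℂ) ≠ 0 := by exact_mod_cast α.den_nz
  -- choice of d
  obtain ⟨d, hd1, hd⟩ : ∃ d : ℕ, 1 ≤ d ∧ (p : ℝ) ^ 2 * z ^ d < 1 := by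
    have h1 : Tendsto (fun d : ℕ => (p : ℝ) ^ 2 * z ^ d) atTop (𝓝 ((p : ℝ) ^ 2 * 0)) :=
      (tendsto_pow_atTop_nhds_zero_of_lt_one hz0.le hz1).const_mul _
    rw [mul_zero] at h1
    obtain ⟨d, h2, h3⟩ := ((eventually_ge_atTop 1).and (h1.eventually_lt_const one_pos)).exists
    exact ⟨d, h2, h3⟩
  obtain ⟨P, hPne, hPdeg, hPdvd⟩ := exists_aux d hd1
    (∑ n ∈ Finset.range (d * d), (X : ℤ[X]) ^ 3 ^ n)
  have hO := auxE_bigO P d (d * d) (d * d) (Nat.lt_pow_self (by norm_num)).le hPdvd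
  have hne := auxE_ne P d hPne
  -- the sequence of points
  have h3 : Tendsto (fun k : ℕ => 3 ^ k) atTop atTop :=
    tendsto_pow_atTop_atTop_of_one_lt (by norm_num)
  have hx0 : Tendsto (fun k : ℕ => (z : ℂ) ^ 3 ^ k) atTop (𝓝 0) :=
    (tendsto_pow_atTop_nhds_zero_of_norm_lt_one (by rw [hzn]; exact hz1)).comp h3
  have hx1 : Tendsto (fun k : ℕ => (z : ℂ) ^ 3 ^ k) atTop (𝓝[≠] 0) :=
    tendsto_nhdsWithin_iff.2 ⟨hx0, Eventually.of_forall fun k => by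
      simp [hz0.ne']⟩
  have hne' := hx1.eventually hne
  obtain ⟨K, hK⟩ := hO.bound
  have hK' := hx0.eventually hK
  -- integrality
  have hint : ∀ k : ℕ, ∃ I : ℤ, ((b : ℂ) ^ d * (p : ℂ) ^ (3 ^ k * (2 * d))) *
      auxE P d ((z : ℂ) ^ 3 ^ k) = I := by
    intro k
    set N := 3 ^ k with hN
    have hS : ∃ B : ℤ, ((b : ℂ) * (p : ℂ) ^ N) * mahlerF ((z : ℂ) ^ N) = B := by
      have h1 := mF_split (z : ℂ) (by rw [hzn]; exact hz1) k
      refine ⟨α.num * p ^ N - b * ∑ n ∈ Finset.range k, (q : ℤ) ^ 3 ^ n * p ^ (N - 3 ^ n), ?_⟩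
      have h2 : mahlerF ((z : ℂ) ^ N) = (α.num : ℂ) / b - ∑ n ∈ Finset.range k, (z : ℂ) ^ 3 ^ n := by
        rw [← hval, h1]; ring
      rw [h2, mul_sub]
      push_cast
      congr 1
      · field_simp
      · rw [mul_assoc, Finset.mul_sum]
        congr 1
        apply Finset.sum_congr rfl
        intro n hn
        have hle : 3 ^ n ≤ N := Nat.pow_le_pow_right (by norm_num) (Finset.mem_range.1 hn).le
        have e : N = 3 ^ n + (N - 3 ^ n) := by omega
        conv_lhs => rw [e, pow_add]
        rw [← hpz, mul_pow]
        ring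
    obtain ⟨B, hB⟩ := hS
    have hPi : ∀ j, ∃ I : ℤ, ((p : ℂ) ^ N) ^ d * aeval ((z : ℂ) ^ N) (P j) = I := by
      intro j
      obtain ⟨I, hI⟩ := int_eval (P j) d (hPdeg j) ((q : ℤ) ^ N) ((p : ℤ) ^ N) ((z : ℂ) ^ N) (by
        push_cast
        rw [← mul_pow, hpz])
      exact ⟨I, by rw [← hI]; push_cast; rfl⟩
    choose I hI using hPi
    refine ⟨∑ j ∈ Finset.range (d + 1), I j * (B ^ j * (b * p ^ N) ^ (d - j)), ?_⟩
    rw [auxE, Finset.mul_sum]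
    push_cast
    apply Finset.sum_congr rfl
    intro j hj
    have e : d = j + (d - j) := by have := Finset.mem_range.1 hj; omega
    rw [← hI, ← hB]
    have e2 : ((b : ℂ) ^ d * (p : ℂ) ^ (N * (2 * d))) =
        ((p : ℂ) ^ N) ^ d * (((b : ℂ) * (p : ℂ) ^ N) ^ j * ((b : ℂ) * (p : ℂ) ^ N) ^ (d - j)) := by
      rw [← pow_add, ← e, mul_pow, ← pow_mul]; ring
    rw [e2]
    ring
  -- the upper bound tends to zero
  have hsmall : Tendsto (fun k : ℕ => (b : ℝ) ^ d * K * (((p : ℝ) ^ 2 * z ^ d) ^ d) ^ 3 ^ k)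
      atTop (𝓝 0) := by
    have h1 := ((tendsto_pow_atTop_nhds_zero_of_lt_one (r := ((p : ℝ) ^ 2 * z ^ d) ^ d)
      (by positivity) (pow_lt_one₀ (by positivity) hd (by omega))).comp h3).const_mul
        ((b : ℝ) ^ d * K)
    simpa using h1
  obtain ⟨k, hk1, hk2, hk3⟩ := (hne'.and (hK'.and (hsmall.eventually_lt_const one_pos))).exists
  obtain ⟨I, hI⟩ := hint k
  have hI0 : I ≠ 0 := by
    rintro rfl
    have : ((b : ℂ) ^ d * (p : ℂ) ^ (3 ^ k * (2 * d))) ≠ 0 := by positivity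
    exact mul_ne_zero this hk1 (by rw [hI]; simp)
  have hI1 : (1 : ℝ) ≤ ‖(I : ℂ)‖ := by
    rw [Complex.norm_intCast]
    exact_mod_cast Int.one_le_abs hI0
  rw [← hI, norm_mul] at hI1
  have h5 : ‖((b : ℂ) ^ d * (p : ℂ) ^ (3 ^ k * (2 * d)))‖ = (b : ℝ) ^ d * (p : ℝ) ^ (3 ^ k * (2 * d)) := by
    simp
  rw [h5] at hI1
  rw [norm_pow, norm_pow, hzn] at hk2
  have h6 : (b : ℝ) ^ d * (p : ℝ) ^ (3 ^ k * (2 * d)) * ‖auxE P d ((z : ℂ) ^ 3 ^ k)‖ ≤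
      (b : ℝ) ^ d * (p : ℝ) ^ (3 ^ k * (2 * d)) * (K * (z ^ 3 ^ k) ^ (d * d)) := by
    gcongr
  have h7 : (b : ℝ) ^ d * (p : ℝ) ^ (3 ^ k * (2 * d)) * (K * (z ^ 3 ^ k) ^ (d * d)) =
      (b : ℝ) ^ d * K * (((p : ℝ) ^ 2 * z ^ d) ^ d) ^ 3 ^ k := by
    simp only [mul_pow, ← pow_mul]
    rw [show 3 ^ k * (2 * d) = 2 * d * 3 ^ k by ring, show 3 ^ k * (d * d) = d * d * 3 ^ k by ring]
    ring
  linarith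

end MahlerAux

/-- The word with 1's exactly at positions 3^n (and 0's elsewhere) represents an
irrational number in any rational base p/q > 2. Here `w i` is the digit at
position `i+1`. -/
theorem powers_of_three_word_irrational (p q : ℕ) (hp : 0 < p) (hq : 2 ≤ q)
    (hcop : Nat.Coprime p q) (hβ : 2 < (p : ℝ) / q)
    (w : ℕ → ℝ)
    (hw1 : ∀ i, (∃ n : ℕ, i + 1 = 3 ^ n) → w i = 1)
    (hw0 : ∀ i, ¬ (∃ n : ℕ, i + 1 = 3 ^ n) → w i = 0) :
    Irrational (∑' i : ℕ, w i * ((q : ℝ) / p) ^ (i + 1)) := by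
  have hq0 : (0 : ℝ) < q := by exact_mod_cast (by omega : 0 < q)
  rw [lt_div_iff₀ hq0] at hβ
  have hlt : q < p := by
    have : (q : ℝ) < p := by linarith
    exact_mod_cast this
  rw [tsum_word w _ hw1 hw0]
  exact gR_irr p q (by omega) hlt
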